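/- Let F be a field, let A be an n×m matrix over F, and let (i_1,j_1),…,(i_s,j_s) be s distinct positions with A having entry 0 at each of these positions. Let U ⊆ F^n ⊗ F^m be the subspace spanned by the pure tensors e_{i_1}⊗e_{j_1},…,e_{i_s}⊗e_{j_s} (where e_i denotes the i-th standard basis vector), identify A with the tensor Σ_{i,j} a_{i,j} (e_i⊗e_j) ∈ F^n⊗F^m, and set rank(A,U) = min{rank(B) : B ∈ A + U}. Define the third-order tensor Â = A⊗e_{s+1} + Σ_{k=1}^s e_{i_k}⊗e_{j_k}⊗e_k ∈ F^n⊗F^m⊗F^{s+1}. Then rank(A,U) + s = rank(Â), where rank(Â) denotes the tensor rank of Â, i.e., the smallest number of pure tensors summing to Â. -/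

import Mathlib

open TensorProduct

/-- The tensor rank of a second-order tensor `T ∈ Fⁿ ⊗ Fᵐ`: the smallest number of
pure tensors `x ⊗ y` summing to `T`. -/
noncomputable def tensorRank2 {F : Type*} [Field F] {n m : ℕ}
    (T : (Fin n → F) ⊗[F] (Fin m → F)) : ℕ :=
  sInf {r : ℕ | ∃ (x : Fin r → Fin n → F) (y : Fin r → Fin m → F),
    T = ∑ i : Fin r, x i ⊗ₜ[F] y i}

/-- The tensor rank of a third-order tensor `T ∈ Fⁿ ⊗ Fᵐ ⊗ Fᵖ`: the smallest number of
pure tensors `x ⊗ y ⊗ z` summing to `T`. -/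
noncomputable def tensorRank3 {F : Type*} [Field F] {n m p : ℕ}
    (T : ((Fin n → F) ⊗[F] (Fin m → F)) ⊗[F] (Fin p → F)) : ℕ :=
  sInf {r : ℕ | ∃ (x : Fin r → Fin n → F) (y : Fin r → Fin m → F) (z : Fin r → Fin p → F),
    T = ∑ i : Fin r, (x i ⊗ₜ[F] y i) ⊗ₜ[F] z i}

/-- `rank(A, U) = min { rank B | B ∈ A + U }`. -/
noncomputable def rankAU {F : Type*} [Field F] {n m : ℕ}
    (A : (Fin n → F) ⊗[F] (Fin m → F))
    (U : Submodule F ((Fin n → F) ⊗[F] (Fin m → F))) : ℕ :=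
  sInf {r : ℕ | ∃ u ∈ U, tensorRank2 (A + u) = r}


/-- Steinitz exchange: if a linearly independent family `P` lies in the span of `w`, then modulo
the span of `P`, the span of `w` is generated by few members of `w`. -/
theorem exists_finset_card_add_le_span_le_sup {K V : Type*} [Field K] [AddCommGroup V] [Module K V]
    {s r : ℕ} {P : Fin s → V} (hP : LinearIndependent K P) {w : Fin r → V}
    (hPw : ∀ k, P k ∈ Submodule.span K (Set.range w)) :
    ∃ J : Finset (Fin r), J.card + s ≤ r ∧
      Submodule.span K (Set.range w) ≤
        Submodule.span K (Set.range P) ⊔ Submodule.span K (w '' J) := by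
  classical
  have hinl : LinearIndepOn K (Sum.elim P w) (Set.range Sum.inl) := by
    rw [linearIndepOn_range_iff Sum.inl_injective]
    simpa using hP
  obtain ⟨b, -, hsb, hspan, hb⟩ :=
    exists_linearIndepOn_extension hinl (Set.subset_univ _)
  refine ⟨Finset.univ.filter fun j => Sum.inr j ∈ b, ?_, ?_⟩
  · have hmem : ∀ i : Fin s ⊕ Fin r, Sum.elim P w i ∈ Submodule.span K (Set.range w) := by
      rintro (k | j)
      · exact hPw k
      · exact Submodule.subset_span ⟨j, rfl⟩
    have hb' : LinearIndependent K fun i : b =>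
        (⟨Sum.elim P w i, hmem i⟩ : Submodule.span K (Set.range w)) :=
      LinearIndependent.of_comp (Submodule.span K (Set.range w)).subtype hb
    have hfin : FiniteDimensional K (Submodule.span K (Set.range w)) :=
      FiniteDimensional.span_of_finite K (Set.finite_range w)
    have hcard := hb'.fintype_card_le_finrank
    have hr : Module.finrank K (Submodule.span K (Set.range w)) ≤ r := by
      simpa [Set.finrank] using finrank_range_le_card (R := K) w
    refine le_trans ?_ (hcard.trans hr)
    let f : {j // j ∈ Finset.univ.filter fun j => Sum.inr j ∈ b} ⊕ Fin s → b :=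
      Sum.elim (fun j => ⟨Sum.inr j.1, (Finset.mem_filter.1 j.2).2⟩)
        (fun k => ⟨Sum.inl k, hsb ⟨k, rfl⟩⟩)
    have hf : Function.Injective f := by
      rintro (⟨j, hj⟩ | k) (⟨j', hj'⟩ | k') h <;> simp_all [f]
    simpa only [Fintype.card_sum, Fintype.card_coe, Fintype.card_fin] using
      Fintype.card_le_of_injective f hf
  · rw [Submodule.span_le]
    rintro _ ⟨j, rfl⟩
    have hj := hspan ⟨Sum.inr j, Set.mem_univ _, rfl⟩
    refine (Submodule.span_le (p := Submodule.span K (Set.range P) ⊔ _)).2 ?_ hj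
    rintro _ ⟨k | i, hi, rfl⟩
    · exact Submodule.mem_sup_left (Submodule.subset_span ⟨k, rfl⟩)
    · exact Submodule.mem_sup_right
        (Submodule.subset_span ⟨i, by simpa using hi, rfl⟩)

theorem exists_eq_sum_tmul_tensorRank2 {F : Type*} [Field F] {n m : ℕ}
    (T : (Fin n → F) ⊗[F] (Fin m → F)) :
    ∃ (x : Fin (tensorRank2 T) → Fin n → F) (y : Fin (tensorRank2 T) → Fin m → F),
      T = ∑ i, x i ⊗ₜ[F] y i :=
  Nat.sInf_mem (s := {r : ℕ | ∃ (x : Fin r → Fin n → F) (y : Fin r → Fin m → F),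
    T = ∑ i : Fin r, x i ⊗ₜ[F] y i}) <| by
    obtain ⟨S, hS⟩ := TensorProduct.exists_finset T
    refine ⟨S.card, fun i => (S.equivFin.symm i).1.1, fun i => (S.equivFin.symm i).1.2, ?_⟩
    rw [S.equivFin.symm.sum_comp (fun j => j.1.1 ⊗ₜ[F] j.1.2), hS]
    exact (S.sum_coe_sort fun j => j.1 ⊗ₜ[F] j.2).symm

theorem exists_tensorRank2_add_eq_rankAU {F : Type*} [Field F] {n m : ℕ}
    (A : (Fin n → F) ⊗[F] (Fin m → F)) (U : Submodule F ((Fin n → F) ⊗[F] (Fin m → F))) :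
    ∃ u ∈ U, tensorRank2 (A + u) = rankAU A U :=
  Nat.sInf_mem (s := {r : ℕ | ∃ u ∈ U, tensorRank2 (A + u) = r}) ⟨_, 0, U.zero_mem, rfl⟩

theorem tensorRank2_le_card {F ι : Type*} [Field F] {n m : ℕ} (J : Finset ι)
    (x : ι → Fin n → F) (y : ι → Fin m → F) :
    tensorRank2 (∑ j ∈ J, x j ⊗ₜ[F] y j) ≤ J.card := by
  refine Nat.sInf_le ⟨fun i => x (J.equivFin.symm i), fun i => y (J.equivFin.symm i), ?_⟩
  rw [J.equivFin.symm.sum_comp (fun j => x j ⊗ₜ[F] y j)]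
  exact (J.sum_coe_sort fun j => x j ⊗ₜ[F] y j).symm

/-- Contraction of a tensor with the `l`-th coordinate functional on its last factor. -/
noncomputable def contractLast (F V : Type*) [Field F] [AddCommGroup V] [Module F V] {p : ℕ}
    (l : Fin p) : V ⊗[F] (Fin p → F) →ₗ[F] V :=
  (TensorProduct.rid F V).toLinearMap ∘ₗ LinearMap.lTensor V (LinearMap.proj l)

@[simp]
theorem contractLast_tmul {F V : Type*} [Field F] [AddCommGroup V] [Module F V] {p : ℕ}
    (l : Fin p) (v : V) (z : Fin p → F) : contractLast F V l (v ⊗ₜ z) = z l • v := by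
  simp [contractLast]

/-- If `p k ⊗ q k` are linearly independent pure tensors with span `U`, then the tensor
obtained by stacking `A` on top of them has rank `rank(A, U) + s`. -/
theorem rankAU_add_eq_tensorRank3 {F : Type*} [Field F] {n m s : ℕ}
    (A : (Fin n → F) ⊗[F] (Fin m → F)) (p : Fin s → Fin n → F) (q : Fin s → Fin m → F)
    (hpq : LinearIndependent F fun k => p k ⊗ₜ[F] q k) :
    rankAU A (Submodule.span F (Set.range fun k => p k ⊗ₜ[F] q k)) + s =
      tensorRank3 (A ⊗ₜ[F] (Pi.single (Fin.last s) 1 : Fin (s + 1) → F) +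
        ∑ k : Fin s, (p k ⊗ₜ[F] q k) ⊗ₜ[F] (Pi.single (Fin.castSucc k) 1 : Fin (s + 1) → F)) := by
  set U := Submodule.span F (Set.range fun k => p k ⊗ₜ[F] q k) with hU
  set T := A ⊗ₜ[F] (Pi.single (Fin.last s) 1 : Fin (s + 1) → F) +
    ∑ k : Fin s, (p k ⊗ₜ[F] q k) ⊗ₜ[F] (Pi.single (Fin.castSucc k) 1 : Fin (s + 1) → F) with hT
  have hmem : ∃ (x : Fin (rankAU A U + s) → Fin n → F) (y : Fin (rankAU A U + s) → Fin m → F)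
      (z : Fin (rankAU A U + s) → Fin (s + 1) → F),
      T = ∑ i, (x i ⊗ₜ[F] y i) ⊗ₜ[F] z i := by
    obtain ⟨u, hu, hrank⟩ := exists_tensorRank2_add_eq_rankAU A U
    obtain ⟨c, rfl⟩ := (Submodule.mem_span_range_iff_exists_fun F).1 hu
    obtain ⟨x, y, hxy⟩ := exists_eq_sum_tmul_tensorRank2 (A + ∑ k, c k • p k ⊗ₜ[F] q k)
    rw [← hrank]
    refine ⟨Fin.append x p, Fin.append y q, Fin.append (fun _ => Pi.single (Fin.last s) 1)
      (fun k => Pi.single (Fin.castSucc k) 1 + (-c k) • Pi.single (Fin.last s) 1), ?_⟩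
    simp only [Fin.sum_univ_add, Fin.append_left, Fin.append_right, ← TensorProduct.sum_tmul, ← hxy]
    simp only [hT, TensorProduct.tmul_add, TensorProduct.add_tmul, Finset.sum_add_distrib,
      TensorProduct.sum_tmul, TensorProduct.tmul_smul, ← TensorProduct.smul_tmul']
    rw [add_add_add_comm, ← Finset.sum_add_distrib]
    refine (add_zero _).symm.trans (congrArg _ (Finset.sum_eq_zero fun k _ => ?_).symm)
    rw [← add_smul, add_neg_cancel, zero_smul]
  apply le_antisymm
  · obtain ⟨x, y, z, h⟩ := Nat.sInf_mem (s := {r : ℕ | ∃ (x : Fin r → Fin n → F)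
      (y : Fin r → Fin m → F) (z : Fin r → Fin (s + 1) → F),
      T = ∑ i : Fin r, (x i ⊗ₜ[F] y i) ⊗ₜ[F] z i}) ⟨_, hmem⟩
    set w := fun i => x i ⊗ₜ[F] y i with hw
    have hP : ∀ k, p k ⊗ₜ[F] q k ∈ Submodule.span F (Set.range w) := fun k => by
      have hk : p k ⊗ₜ[F] q k = ∑ i, z i k.castSucc • w i := by
        simpa [hT, Pi.single_apply, Fin.castSucc_ne_last] using
          congrArg (contractLast F _ k.castSucc) h
      rw [hk]
      exact Submodule.sum_mem _ fun i _ => Submodule.smul_mem _ _ (Submodule.subset_span ⟨i, rfl⟩)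
    have hA : A ∈ Submodule.span F (Set.range w) := by
      have hlast : A = ∑ i, z i (Fin.last s) • w i := by
        simpa [hT, (Fin.castSucc_ne_last _).symm] using congrArg (contractLast F _ (Fin.last s)) h
      rw [hlast]
      exact Submodule.sum_mem _ fun i _ => Submodule.smul_mem _ _ (Submodule.subset_span ⟨i, rfl⟩)
    obtain ⟨J, hJ, hspan⟩ := exists_finset_card_add_le_span_le_sup hpq hP
    refine le_trans (Nat.add_le_add_right ?_ s) hJ
    obtain ⟨v, hv, b, hb, hvb⟩ := Submodule.mem_sup.1 (hspan hA)
    obtain ⟨d, rfl⟩ := (Submodule.mem_span_image_finset_iff_exists_fun F).1 hb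
    have hAv : A + -v = ∑ j ∈ J.attach, (d j • x j) ⊗ₜ[F] y j := by
      simp only [← TensorProduct.smul_tmul', ← hvb, hw, Finset.univ_eq_attach]
      abel
    refine le_trans (Nat.sInf_le ⟨-v, neg_mem hv, rfl⟩) ?_
    rw [hAv, ← J.card_attach]
    exact tensorRank2_le_card J.attach (fun j => d j • x j) fun j => y j
  · exact Nat.sInf_le hmem

/-- matrix completion as tensor rank. `A` is an `n × m` matrix, zero at the
`s` distinct undetermined positions `idx k = (i_k, j_k)`, identified with the tensor
`∑ᵢ∑ⱼ a_{ij} (eᵢ ⊗ eⱼ)`; `U` is spanned by the `e_{i_k} ⊗ e_{j_k}`. Then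
`rank(A,U) + s = rank(Â)`. -/
theorem matrix_completion_rank_eq_tensorRank_hat {F : Type*} [Field F] {n m s : ℕ}
    (A : Matrix (Fin n) (Fin m) F) (idx : Fin s → Fin n × Fin m)
    (hdist : Function.Injective idx)
    (hzero : ∀ k : Fin s, A (idx k).1 (idx k).2 = 0) :
    rankAU
        (∑ i : Fin n, ∑ j : Fin m,
          A i j • ((Pi.single i 1 : Fin n → F) ⊗ₜ[F] (Pi.single j 1 : Fin m → F)))
        (Submodule.span F (Set.range fun k : Fin s =>
          (Pi.single (idx k).1 1 : Fin n → F) ⊗ₜ[F] (Pi.single (idx k).2 1 : Fin m → F)))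
      + s =
    tensorRank3
      ((∑ i : Fin n, ∑ j : Fin m,
          A i j • ((Pi.single i 1 : Fin n → F) ⊗ₜ[F] (Pi.single j 1 : Fin m → F)))
          ⊗ₜ[F] (Pi.single (Fin.last s) 1 : Fin (s + 1) → F)
        + ∑ k : Fin s,
            ((Pi.single (idx k).1 1 : Fin n → F) ⊗ₜ[F] (Pi.single (idx k).2 1 : Fin m → F))
              ⊗ₜ[F] (Pi.single (Fin.castSucc k) 1 : Fin (s + 1) → F)) := by
  refine rankAU_add_eq_tensorRank3 _ _ _ ?_
  have h := ((Pi.basisFun F (Fin n)).tensorProduct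
    (Pi.basisFun F (Fin m))).linearIndependent.comp idx hdist
  have hcomp : ⇑((Pi.basisFun F (Fin n)).tensorProduct (Pi.basisFun F (Fin m))) ∘ idx = fun k =>
      (Pi.single (idx k).1 1 : Fin n → F) ⊗ₜ[F] (Pi.single (idx k).2 1 : Fin m → F) := by
    funext k
    simp [Module.Basis.tensorProduct_apply']
  rw [hcomp] at h
  exact h
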